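/- arXiv:0907.2554 — 6 statements merged into one kernel-verified Lean document; each statement's English description precedes it below -/
import Mathlib

section
/- Let a and b be coprime integers with a > 2b > 0, and set g = (a² + ab − b² − 2a + 1)/2 and p = a² + ab − b² (regarded as real numbers). Then 2g + (2√(40g+1))/5 + 3/5 ≤ p, and equality holds if and only if a = 2b + 1. (This is the arithmetic content of Theorem 3.2: the knot k⁻(a,b) has Seifert genus (a²+ab−b²−2a+1)/2 and Berge's surgery on it yields the lens space L(p,q) with p = a²+ab−b², so 2g + (2√(40g+1))/5 + 3/5 ≤ |p| with equality exactly for k⁻(2j+1,j).) -/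
/-- Arithmetic content of Theorem 3.2: for coprime integers `a > 2b > 0`,
with `g = (a² + ab - b² - 2a + 1)/2` and `p = a² + ab - b²` as real numbers,
`2g + (2√(40g+1))/5 + 3/5 ≤ p`, with equality iff `a = 2b + 1`. -/
theorem kminus_lens_space_lower_bound (a b : ℤ) (hab : a > 2 * b) (hb : 2 * b > 0)
    (hcop : Int.gcd a b = 1)
    (g p : ℝ)
    (hg : g = ((a : ℝ) ^ 2 + (a : ℝ) * (b : ℝ) - (b : ℝ) ^ 2 - 2 * (a : ℝ) + 1) / 2)
    (hp : p = (a : ℝ) ^ 2 + (a : ℝ) * (b : ℝ) - (b : ℝ) ^ 2) :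
    2 * g + 2 * Real.sqrt (40 * g + 1) / 5 + 3 / 5 ≤ p ∧
      (2 * g + 2 * Real.sqrt (40 * g + 1) / 5 + 3 / 5 = p ↔ a = 2 * b + 1) := by
  have hb1 : (1 : ℝ) ≤ b := by exact_mod_cast (by omega : 1 ≤ b)
  have hab1 : (2 * b + 1 : ℝ) ≤ a := by exact_mod_cast (by omega : 2 * b + 1 ≤ a)
  have hpos : (0 : ℝ) ≤ 5 * a - 4 := by linarith
  have key : 40 * g + 1 = (5 * a - 4 : ℝ) ^ 2 - 5 * ((a - 2 * b) ^ 2 - 1) := by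
    rw [hg]; ring
  have hnonneg : 0 ≤ 40 * g + 1 := by
    rw [hg]
    nlinarith [sq_nonneg ((a : ℝ) - 1),
      mul_nonneg (by linarith : (0 : ℝ) ≤ b) (by linarith : (0 : ℝ) ≤ a - b)]
  have hle : √(40 * g + 1) ≤ 5 * a - 4 :=
    Real.sqrt_le_iff.mpr ⟨hpos, by nlinarith⟩
  have hgap : p - 2 * g = 2 * a - 1 := by rw [hp, hg]; ring
  refine ⟨by linarith, fun h => ?_, fun h => ?_⟩
  · have hsqrt : √(40 * g + 1) = 5 * a - 4 := by linarith
    have hsq := Real.sq_sqrt hnonneg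
    rw [hsqrt] at hsq
    have : (a : ℝ) = 2 * b + 1 := by nlinarith
    exact_mod_cast this
  · have ha : (a : ℝ) = 2 * b + 1 := by exact_mod_cast h
    have hsqrt : √(40 * g + 1) = 5 * a - 4 := by
      rw [key, show (5 * a - 4 : ℝ) ^ 2 - 5 * ((a - 2 * b) ^ 2 - 1) = (5 * a - 4) ^ 2 by
        rw [ha]; ring, Real.sqrt_sq hpos]
    linarith
end

section
/- For all integers a and b with a > 2b > 0, one has √(20(a² + ab − b² − 2a + 1) + 1) ≤ 5a − 4, and equality holds if and only if a = 2b + 1. (Key step in the proof of Theorem 3.2; it follows from the identity (5a−4)² − (20(a²+ab−b²−2a+1)+1) = 5(a−2b)² − 5.) -/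
/-- Key step in the proof of Theorem 3.2: for integers `a > 2b > 0`,
`√(20(a² + ab - b² - 2a + 1) + 1) ≤ 5a - 4`, with equality iff `a = 2b + 1`. -/
theorem sqrt_ineq_kminus (a b : ℤ) (hab : a > 2 * b) (hb : 2 * b > 0) :
    Real.sqrt (20 * ((a : ℝ) ^ 2 + (a : ℝ) * (b : ℝ) - (b : ℝ) ^ 2 - 2 * (a : ℝ) + 1) + 1)
        ≤ 5 * (a : ℝ) - 4 ∧
      (Real.sqrt (20 * ((a : ℝ) ^ 2 + (a : ℝ) * (b : ℝ) - (b : ℝ) ^ 2 - 2 * (a : ℝ) + 1) + 1)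
          = 5 * (a : ℝ) - 4 ↔ a = 2 * b + 1) := by
  have hd : (1 : ℝ) ≤ a - 2 * b := by
    have h : 1 ≤ a - 2 * b := by omega
    exact_mod_cast h
  have ha : (0 : ℝ) < 5 * a - 4 := by
    have h : 0 < 5 * a - 4 := by omega
    exact_mod_cast h
  refine ⟨Real.sqrt_le_iff.mpr ⟨ha.le, by nlinarith⟩, ?_⟩
  rw [Real.sqrt_eq_iff_mul_self_eq_of_pos ha]
  constructor
  · intro h
    have h_one : (a : ℝ) - 2 * b = 1 := by nlinarith
    have h_cast : (a : ℝ) = 2 * b + 1 := by linarith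
    exact_mod_cast h_cast
  · rintro rfl
    push_cast
    ring
end

section
/- For every integer j ≥ 2, setting p = 5j² + 5j + 1, q = 5j² − 3 and u = 5j² − 2, the set of integers i with 1 ≤ i < 5j + 2 such that the residue of i·q modulo p is greater than u is exactly {j+1, 2j+1, 3j+1, 4j+1}; consequently Φ_{p,q}(u) = #{i : 1 ≤ i < 5j+2, φ_i < u} = 5j − 3. (Computation of Φ for the dual knot of k⁻(2j+1,j) in the proof of Theorem 3.3, in the parametrization (p,q,u) = (5j²+5j+1, 5j²−3, 5j²−2); note that no i with 1 ≤ i < Ψ_{p,q}(u) = 5j+2 has φ_i = u.) -/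
/-- With `p = 5j² + 5j + 1` and `q = 5j² − 3`, the residue of `(aj + b)q` modulo `p`, for `0 ≤ a ≤ 4`
and `1 ≤ b ≤ j`. -/
lemma mul_add_mul_emod_eq {j a b : ℤ} (ha : 0 ≤ a) (ha' : a ≤ 4) (hb : 1 ≤ b) (hb' : b ≤ j) :
    (a * j + b) * (5 * j ^ 2 - 3) % (5 * j ^ 2 + 5 * j + 1) =
      5 * j ^ 2 + 5 * j + 1 - (b * (5 * j + 4) - a * (j + 1)) := by
  have h : (a * j + b) * (5 * j ^ 2 - 3) =
      5 * j ^ 2 + 5 * j + 1 - (b * (5 * j + 4) - a * (j + 1)) +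
        (5 * j ^ 2 + 5 * j + 1) * (a * j + b - a - 1) := by ring
  rw [h, Int.add_mul_emod_self_left]
  apply Int.emod_eq_of_lt <;> nlinarith

/-- For `1 ≤ i < 5j + 2`, the residue of `iq` never equals `u = 5j² − 2`, and it exceeds `u` exactly
at the four values `j + 1, 2j + 1, 3j + 1, 4j + 1`. -/
lemma residue_gt_or_lt {j i : ℤ} (hj : 2 ≤ j) (hi : 1 ≤ i) (hi' : i < 5 * j + 2) :
    ((i = j + 1 ∨ i = 2 * j + 1 ∨ i = 3 * j + 1 ∨ i = 4 * j + 1) ∧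
        5 * j ^ 2 - 2 < i * (5 * j ^ 2 - 3) % (5 * j ^ 2 + 5 * j + 1)) ∨
      (¬(i = j + 1 ∨ i = 2 * j + 1 ∨ i = 3 * j + 1 ∨ i = 4 * j + 1) ∧
        i * (5 * j ^ 2 - 3) % (5 * j ^ 2 + 5 * j + 1) < 5 * j ^ 2 - 2) := by
  by_cases hlast : i = 5 * j + 1
  · subst hlast
    right
    have h : (5 * j + 1) * (5 * j ^ 2 - 3) = 1 + (5 * j ^ 2 + 5 * j + 1) * (5 * j - 4) := by ring
    refine ⟨by omega, ?_⟩
    rw [h, Int.add_mul_emod_self_left, Int.emod_eq_of_lt] <;> nlinarith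
  obtain ⟨a, b, ha, ha', hb, hb', rfl⟩ :
      ∃ a b : ℤ, 0 ≤ a ∧ a ≤ 4 ∧ 1 ≤ b ∧ b ≤ j ∧ i = a * j + b := by
    refine ⟨(i - 1) / j, (i - 1) % j + 1, Int.ediv_nonneg (by omega) (by omega), ?_, ?_, ?_, ?_⟩
    · exact Int.le_of_lt_add_one (Int.ediv_lt_of_lt_mul (by omega) (by omega))
    · linarith [Int.emod_nonneg (i - 1) (show j ≠ 0 by omega)]
    · linarith [Int.emod_lt_of_pos (i - 1) (show 0 < j by omega)]
    · linarith [Int.ediv_mul_add_emod (i - 1) j]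
  rw [mul_add_mul_emod_eq ha ha' hb hb']
  rcases hb.eq_or_lt with rfl | hb2
  · interval_cases a
    · right
      constructor <;> [omega; linarith]
    all_goals
      left
      constructor <;> [omega; linarith]
  · right
    constructor
    · interval_cases a <;> omega
    · nlinarith

/-- Computation of `Φ_{p,q}(u)` for the dual knot of `k⁻(2j+1,j)`:
with `p = 5j² + 5j + 1`, `q = 5j² − 3`, `u = 5j² − 2`, the integers `i`
with `1 ≤ i < 5j + 2` whose residue `φ_i = (i·q) mod p` exceeds `u` are
exactly `j+1, 2j+1, 3j+1, 4j+1`; consequently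
`Φ_{p,q}(u) = #{i : 1 ≤ i < 5j+2, φ_i < u} = 5j − 3`. -/
theorem phi_dual_knot (j : ℤ) (hj : j ≥ 2) (p q u : ℤ)
    (hp : p = 5 * j ^ 2 + 5 * j + 1) (hq : q = 5 * j ^ 2 - 3) (hu : u = 5 * j ^ 2 - 2) :
    {i : ℤ | 1 ≤ i ∧ i < 5 * j + 2 ∧ u < i * q % p} =
        {j + 1, 2 * j + 1, 3 * j + 1, 4 * j + 1} ∧
      (((Finset.Ico (1 : ℤ) (5 * j + 2)).filter (fun i => i * q % p < u)).card : ℤ) =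
        5 * j - 3 := by
  subst hp hq hu
  constructor
  · ext i
    simp only [Set.mem_ofPred_eq, Set.mem_insert_iff, Set.mem_singleton_iff]
    constructor
    · rintro ⟨h1, h2, h3⟩
      rcases residue_gt_or_lt hj h1 h2 with h | h
      · exact h.1
      · exact absurd h3 h.2.not_gt
    · intro h
      have h1 : 1 ≤ i := by omega
      have h2 : i < 5 * j + 2 := by omega
      rcases residue_gt_or_lt hj h1 h2 with h' | h'
      · exact ⟨h1, h2, h'.2⟩
      · exact absurd h h'.1
  · have hfilter : (Finset.Ico (1 : ℤ) (5 * j + 2)).filter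
        (fun i => i * (5 * j ^ 2 - 3) % (5 * j ^ 2 + 5 * j + 1) < 5 * j ^ 2 - 2) =
        Finset.Ico (1 : ℤ) (5 * j + 2) \ {j + 1, 2 * j + 1, 3 * j + 1, 4 * j + 1} := by
      ext i
      simp only [Finset.mem_filter, Finset.mem_sdiff, Finset.mem_insert, Finset.mem_singleton,
        Finset.mem_Ico]
      refine and_congr_right fun hi => ?_
      rcases residue_gt_or_lt hj hi.1 hi.2 with h | h
      · exact iff_of_false h.2.not_gt (not_not_intro h.1)
      · exact iff_of_true h.2 h.1
    have hsub : ({j + 1, 2 * j + 1, 3 * j + 1, 4 * j + 1} : Finset ℤ) ⊆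
        Finset.Ico (1 : ℤ) (5 * j + 2) := by
      intro i
      simp only [Finset.mem_insert, Finset.mem_singleton, Finset.mem_Ico]
      omega
    have hcard : ({j + 1, 2 * j + 1, 3 * j + 1, 4 * j + 1} : Finset ℤ).card = 4 := by
      repeat rw [Finset.card_insert_of_notMem
        (by simp only [Finset.mem_insert, Finset.mem_singleton]; omega)]
      rw [Finset.card_singleton]
    rw [hfilter, Finset.card_sdiff_of_subset hsub, hcard, Int.card_Ico]
    omega
end

section
/- For every integer j ≥ 2, setting p = 5j² + 5j + 1, q = 5j² − 3 and u = 5j² − 2, one has Φ̃_{p,q}(u) = min{Φ_{p,q}(u), Φ_{p,q}(u) − Ψ_{p,q}(u) + p − u, Ψ_{p,q}(u) − Φ_{p,q}(u) − 1, u − Φ_{p,q}(u) − 1} = min{5j−3, 5j−2, 4, 5j²−5j} = 4. In particular Φ̃_{p,q}(u) ≥ 2. (This is the combinatorial core of Theorem 3.3: the dual knot K* of k⁻(2j+1,j) satisfies Φ(K*) = 4 ≥ 2, whence k⁻(2j+1,j) is hyperbolic by Lemma 3.5.) -/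
/-- The inverse of `5j² - 3` modulo `5j² + 5j + 1` is `5j + 1`, which pins down `Ψ`. -/
theorem eq_of_mul_modEq_dual {j x : ℤ} (hj : 2 ≤ j) (hx : 1 ≤ x) (hxp : x ≤ 5 * j ^ 2 + 5 * j + 1)
    (h : x * (5 * j ^ 2 - 3) ≡ 5 * j ^ 2 - 2 [ZMOD 5 * j ^ 2 + 5 * j + 1]) : x = 5 * j + 2 := by
  obtain ⟨c, hc⟩ := h.dvd
  have hd : (5 * j ^ 2 + 5 * j + 1) ∣ x - (5 * j + 2) :=
    ⟨-(5 * j + 1) * c + (5 * j - 4) - x * (5 * j - 4), by linear_combination -(5 * j + 1) * hc⟩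
  have h0 := Int.eq_zero_of_abs_lt_dvd hd (by rw [abs_lt]; constructor <;> nlinarith)
  linarith

theorem emod_eq_of_eq_mul_add {a p m r : ℤ} (h : a = p * m + r) (h0 : 0 ≤ r) (h1 : r < p) :
    a % p = r := by
  rw [h, Int.mul_add_emod_self_left, Int.emod_eq_of_lt h0 h1]

theorem mul_emod_lt_iff_dual {j i : ℤ} (hj : 2 ≤ j) (hi : 1 ≤ i) (hi' : i < 5 * j + 2) :
    i * (5 * j ^ 2 - 3) % (5 * j ^ 2 + 5 * j + 1) < 5 * j ^ 2 - 2 ↔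
      i ∉ ({j + 1, 2 * j + 1, 3 * j + 1, 4 * j + 1} : Finset ℤ) := by
  simp only [Finset.mem_insert, Finset.mem_singleton]
  obtain ⟨k, r, hk, hr, hrj, rfl⟩ : ∃ k r : ℤ, 0 ≤ k ∧ 0 ≤ r ∧ r < j ∧ i = k * j + 1 + r :=
    ⟨(i - 1) / j, (i - 1) % j, Int.ediv_nonneg (by linarith) (by linarith),
      Int.emod_nonneg _ (by linarith), Int.emod_lt_of_pos _ (by linarith),
      by linarith [Int.ediv_mul_add_emod (i - 1) j]⟩
  have hk5 : k ≤ 5 := by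
    by_contra! hlt
    nlinarith
  obtain rfl | hk4 := hk5.eq_or_lt
  · obtain rfl : r = 0 := by linarith
    rw [emod_eq_of_eq_mul_add (m := 5 * j - 4) (r := 1) (by ring) (by norm_num) (by nlinarith)]
    exact iff_of_true (by nlinarith) (by omega)
  · rw [emod_eq_of_eq_mul_add (m := k * j + r - k)
      (r := 5 * j ^ 2 + 5 * j + 1 - (5 * j + 4 - k * (j + 1) + r * (5 * j + 4)))
      (by ring) (by nlinarith) (by nlinarith)]
    obtain rfl | hr1 := hr.eq_or_lt
    · interval_cases k <;> omega
    · exact iff_of_true (by nlinarith) (by interval_cases k <;> omega)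

theorem card_filter_mul_emod_lt_dual {j : ℤ} (hj : 2 ≤ j) :
    (((Finset.Ico (1 : ℤ) (5 * j + 2)).filter
      (fun i => i * (5 * j ^ 2 - 3) % (5 * j ^ 2 + 5 * j + 1) < 5 * j ^ 2 - 2)).card : ℤ) =
      5 * j - 3 := by
  have hfilter : (Finset.Ico (1 : ℤ) (5 * j + 2)).filter
      (fun i => i * (5 * j ^ 2 - 3) % (5 * j ^ 2 + 5 * j + 1) < 5 * j ^ 2 - 2) =
      Finset.Ico 1 (5 * j + 2) \ {j + 1, 2 * j + 1, 3 * j + 1, 4 * j + 1} := by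
    ext i
    rw [Finset.mem_filter, Finset.mem_sdiff]
    refine and_congr_right fun h => ?_
    rw [Finset.mem_Ico] at h
    exact mul_emod_lt_iff_dual hj h.1 h.2
  have hsub : ({j + 1, 2 * j + 1, 3 * j + 1, 4 * j + 1} : Finset ℤ) ⊆ Finset.Ico 1 (5 * j + 2) := by
    intro i
    simp only [Finset.mem_insert, Finset.mem_singleton, Finset.mem_Ico]
    omega
  have hcard : ({j + 1, 2 * j + 1, 3 * j + 1, 4 * j + 1} : Finset ℤ).card = 4 := by
    repeat rw [Finset.card_insert_of_notMem
      (by simp only [Finset.mem_insert, Finset.mem_singleton]; omega)]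
    rw [Finset.card_singleton]
  rw [hfilter, Finset.card_sdiff_of_subset hsub, hcard, Int.card_Ico]
  omega

/-- Combinatorial core of Theorem 3.3: with `p = 5j² + 5j + 1`, `q = 5j² − 3`,
`u = 5j² − 2` (for `j ≥ 2`), if `Ψ` is the unique integer in `[1,p]` with
`Ψ·q ≡ u (mod p)` and `Φ = #{i : 1 ≤ i < Ψ, (i·q mod p) < u}`, then
`Φ̃ = min{Φ, Φ − Ψ + p − u, Ψ − Φ − 1, u − Φ − 1}
   = min{5j−3, 5j−2, 4, 5j²−5j} = 4`; in particular `Φ̃ ≥ 2`. -/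
theorem phiTilde_dual_knot (j : ℤ) (hj : j ≥ 2) (p q u : ℤ)
    (hp : p = 5 * j ^ 2 + 5 * j + 1) (hq : q = 5 * j ^ 2 - 3) (hu : u = 5 * j ^ 2 - 2)
    (Ψ : ℤ) (hΨ : 1 ≤ Ψ ∧ Ψ ≤ p ∧ Ψ * q ≡ u [ZMOD p])
    (Φ : ℤ)
    (hΦ : Φ = (((Finset.Ico (1 : ℤ) Ψ).filter (fun i => i * q % p < u)).card : ℤ)) :
    min (min (min Φ (Φ - Ψ + p - u)) (Ψ - Φ - 1)) (u - Φ - 1) =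
        min (min (min (5 * j - 3) (5 * j - 2)) 4) (5 * j ^ 2 - 5 * j) ∧
      min (min (min Φ (Φ - Ψ + p - u)) (Ψ - Φ - 1)) (u - Φ - 1) = 4 ∧
      2 ≤ min (min (min Φ (Φ - Ψ + p - u)) (Ψ - Φ - 1)) (u - Φ - 1) := by
  subst hp hq hu
  obtain rfl := eq_of_mul_modEq_dual hj hΨ.1 hΨ.2.1 hΨ.2.2
  rw [card_filter_mul_emod_lt_dual hj] at hΦ
  subst hΦ
  have h4 : 4 ≤ 5 * j ^ 2 - 5 * j := by nlinarith
  omega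
end

section
/- For every integer j ≥ 2, setting p = 9j, q = 3j−1 and u = 3j+1, the set of integers i with 1 ≤ i < 3j−1 such that the residue of i·q modulo p is less than u is exactly {3k+1 : 0 ≤ k ≤ j−1}; consequently Φ_{p,q}(u) = j. (Computation of Φ for the dual knot K*_j = K(L(9j,3j−1); 3j+1) in the proof of the Proposition of Section 5; concretely, the residue of (3k+1)(3j−1) modulo 9j equals 3(j−k)−1 < 3j+1 for 0 ≤ k ≤ j−1, while all other i with 1 ≤ i < 3j−1 have residue greater than 3j+1.) -/
/-- Among the integers `1 ≤ i < 3j - 1`, those with `i * (3j - 1) mod 9j < 3j + 1` are exactly the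
ones congruent to `1` modulo `3`. -/
theorem mul_emod_lt_iff_exists_three_mul_add_one {i j : ℤ} (h1 : 1 ≤ i) (h2 : i < 3 * j - 1) :
    i * (3 * j - 1) % (9 * j) < 3 * j + 1 ↔ ∃ k : ℤ, i = 3 * k + 1 := by
  have emod_eq (r k : ℤ) (hr : 0 ≤ r) (hr' : r < 9 * j) (h : i * (3 * j - 1) = r + 9 * j * k) :
      i * (3 * j - 1) % (9 * j) = r := by
    rw [h, Int.add_mul_emod_self_left, Int.emod_eq_of_lt hr hr']
  obtain ⟨k, rfl | rfl | rfl⟩ : ∃ k, i = 3 * k ∨ i = 3 * k + 1 ∨ i = 3 * k + 2 :=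
    ⟨i / 3, by omega⟩
  · rw [emod_eq (9 * j - 3 * k) (k - 1) (by omega) (by omega) (by ring)]
    omega
  · rw [emod_eq (3 * (j - k) - 1) k (by omega) (by omega) (by ring)]
    exact ⟨fun _ => ⟨k, rfl⟩, fun _ => by omega⟩
  · rw [emod_eq (6 * j - 3 * k - 2) k (by omega) (by omega) (by ring)]
    omega


/-- Computation of `Φ_{p,q}(u)` for the dual knot `K*_j = K(L(9j,3j−1); 3j+1)`:
for `j ≥ 2`, with `p = 9j`, `q = 3j−1`, `u = 3j+1`, the integers `i` with
`1 ≤ i < 3j−1` whose residue `φ_i = (i·q) mod p` is less than `u` are exactly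
`{3k+1 : 0 ≤ k ≤ j−1}`; consequently `Φ_{p,q}(u) = j`. -/
theorem phi_dual_knot_typeV (j : ℤ) (hj : j ≥ 2) (p q u : ℤ)
    (hp : p = 9 * j) (hq : q = 3 * j - 1) (hu : u = 3 * j + 1) :
    {i : ℤ | 1 ≤ i ∧ i < 3 * j - 1 ∧ i * q % p < u} =
        {i : ℤ | ∃ k : ℤ, 0 ≤ k ∧ k ≤ j - 1 ∧ i = 3 * k + 1} ∧
      (((Finset.Ico (1 : ℤ) (3 * j - 1)).filter (fun i => i * q % p < u)).card : ℤ) = j := by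
  subst hp hq hu
  have mem_iff (i : ℤ) : (1 ≤ i ∧ i < 3 * j - 1 ∧ i * (3 * j - 1) % (9 * j) < 3 * j + 1) ↔
      ∃ k : ℤ, 0 ≤ k ∧ k ≤ j - 1 ∧ i = 3 * k + 1 := by
    constructor
    · rintro ⟨h1, h2, h3⟩
      obtain ⟨k, rfl⟩ := (mul_emod_lt_iff_exists_three_mul_add_one h1 h2).1 h3
      exact ⟨k, by omega, by omega, rfl⟩
    · rintro ⟨k, hk0, hk1, rfl⟩
      have h1 : 1 ≤ 3 * k + 1 := by omega
      have h2 : 3 * k + 1 < 3 * j - 1 := by omega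
      exact ⟨h1, h2, (mul_emod_lt_iff_exists_three_mul_add_one h1 h2).2 ⟨k, rfl⟩⟩
  refine ⟨Set.ext mem_iff, ?_⟩
  have filter_eq : (Finset.Ico (1 : ℤ) (3 * j - 1)).filter
      (fun i => i * (3 * j - 1) % (9 * j) < 3 * j + 1) =
        (Finset.Ico (0 : ℤ) j).image (fun k => 3 * k + 1) := by
    ext i
    simp only [Finset.mem_filter, Finset.mem_Ico, Finset.mem_image, and_assoc, mem_iff,
      Int.le_sub_one_iff, eq_comm]
  rw [filter_eq, Finset.card_image_of_injective _ fun a b h => by simpa using h, Int.card_Ico]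
  omega
end

section
/- For every integer j ≥ 2, setting p = 9j, q = 3j−1 and u = 3j+1, one has Φ̃_{p,q}(u) = min{Φ_{p,q}(u), Φ_{p,q}(u) − Ψ_{p,q}(u) + p − u, Ψ_{p,q}(u) − Φ_{p,q}(u) − 1, u − Φ_{p,q}(u) − 1} = min{j, 4j−2, 2j−2, 2j} = j, and in particular Φ̃_{p,q}(u) ≥ 2. (This is the combinatorial core of the hyperbolicity claim in the Proposition of Section 5: the dual knot K*_j = K(L(9j,3j−1); 3j+1) of K_j satisfies Φ(K*_j) ≥ 2, whence K_j is hyperbolic by Lemma 3.5.) -/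
/-- Modulo `9 * j`, the residue `3 * j + 1` is first attained by the multiples of `3 * j - 1`
at index `3 * j - 1`. -/
lemma eq_of_mul_modEq {j x : ℤ} (hj : 1 ≤ j) (h1 : 1 ≤ x) (h2 : x ≤ 9 * j)
    (h : x * (3 * j - 1) ≡ 3 * j + 1 [ZMOD 9 * j]) : x = 3 * j - 1 := by
  obtain ⟨c, hc⟩ := h.symm.dvd
  have key : x - (3 * j - 1) = 9 * j * (j * x - (3 * j + 1) * c - j - 1) := by
    linear_combination -(3 * j + 1) * hc
  have hd : 9 * j ∣ x - (3 * j - 1) := ⟨_, key⟩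
  have h0 := Int.eq_zero_of_abs_lt_dvd hd (by rw [abs_lt]; constructor <;> linarith)
  linarith

lemma filter_mul_emod_lt_eq_image {j : ℤ} (hj : 1 ≤ j) :
    (Finset.Ico (1 : ℤ) (3 * j - 1)).filter (fun i => i * (3 * j - 1) % (9 * j) < 3 * j + 1) =
      (Finset.Ico (0 : ℤ) j).image (fun k => 3 * k + 1) := by
  have residue (i k r : ℤ) (h : i * (3 * j - 1) = r + 9 * j * k) (h0 : 0 ≤ r) (h1 : r < 9 * j) :
      i * (3 * j - 1) % (9 * j) = r := by
    rw [h, Int.add_mul_emod_self_left, Int.emod_eq_of_lt h0 h1]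
  ext i
  simp only [Finset.mem_filter, Finset.mem_Ico, Finset.mem_image]
  constructor
  · rintro ⟨⟨h1, h2⟩, h3⟩
    obtain ⟨k, rfl | rfl | rfl⟩ : ∃ k, i = 3 * k ∨ i = 3 * k + 1 ∨ i = 3 * k + 2 :=
      ⟨i / 3, by omega⟩
    · rw [residue _ (k - 1) (9 * j - 3 * k) (by ring) (by omega) (by omega)] at h3
      omega
    · exact ⟨k, by omega, rfl⟩
    · rw [residue _ k (6 * j - 3 * k - 2) (by ring) (by omega) (by omega)] at h3
      omega
  · rintro ⟨k, ⟨h1, h2⟩, rfl⟩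
    rw [residue _ k (3 * j - 3 * k - 1) (by ring) (by omega) (by omega)]
    omega

/-- Combinatorial core of the hyperbolicity claim in the Proposition of
Section 5: with `p = 9j`, `q = 3j−1`, `u = 3j+1` (for `j ≥ 2`), if `Ψ` is the
unique integer in `[1,p]` with `Ψ·q ≡ u (mod p)` and
`Φ = #{i : 1 ≤ i < Ψ, (i·q mod p) < u}`, then
`Φ̃ = min{Φ, Φ − Ψ + p − u, Ψ − Φ − 1, u − Φ − 1}
   = min{j, 4j−2, 2j−2, 2j} = j`; in particular `Φ̃ ≥ 2`. -/
theorem phiTilde_dual_knot_typeV (j : ℤ) (hj : j ≥ 2) (p q u : ℤ)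
    (hp : p = 9 * j) (hq : q = 3 * j - 1) (hu : u = 3 * j + 1)
    (Ψ : ℤ) (hΨ : 1 ≤ Ψ ∧ Ψ ≤ p ∧ Ψ * q ≡ u [ZMOD p])
    (Φ : ℤ)
    (hΦ : Φ = (((Finset.Ico (1 : ℤ) Ψ).filter (fun i => i * q % p < u)).card : ℤ)) :
    min (min (min Φ (Φ - Ψ + p - u)) (Ψ - Φ - 1)) (u - Φ - 1) =
        min (min (min j (4 * j - 2)) (2 * j - 2)) (2 * j) ∧
      min (min (min Φ (Φ - Ψ + p - u)) (Ψ - Φ - 1)) (u - Φ - 1) = j ∧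
      2 ≤ min (min (min Φ (Φ - Ψ + p - u)) (Ψ - Φ - 1)) (u - Φ - 1) := by
  subst hp hq hu
  obtain ⟨h1, h2, h3⟩ := hΨ
  obtain rfl := eq_of_mul_modEq (by omega) h1 h2 h3
  rw [filter_mul_emod_lt_eq_image (by omega),
    Finset.card_image_of_injective _ (fun a b h => by simpa using h), Int.card_Ico] at hΦ
  omega
end
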